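/- arXiv:2310.19314 — 3 statements merged into one kernel-verified Lean document; each statement's English description precedes it below -/
import Mathlib

section
/- Let G = (S, T, π) be a countable two-person win-lose game such that the family B¹_down(G) is ascending-union closed. Then for every mixed strategy q of player 2 there exists a pure strategy s ∈ S such that π^mix(s, q) = sup over mixed strategies p on S of π^mix(p, q); that is, player 1 always has an exact pure best response. -/
open scoped ENNReal Classical

/-- The expected payoff to player 1 (probability that player 1 wins) when player 1
uses mixed strategy `p` and player 2 uses mixed strategy `q`. -/
noncomputable def mixedPayoff {S T : Type*} (π : S → T → Prop) (p : PMF S) (q : PMF T) : ℝ≥0∞ :=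
  ∑' s, ∑' t, p s * q t * (if π s t then 1 else 0)

/-- A family of sets is ascending-union closed if the union of every countable
strictly ascending chain of members of the family is again a member. -/
def AscendingUnionClosed {X : Type*} (F : Set (Set X)) : Prop :=
  ∀ A : ℕ → Set X, (∀ i, A i ∈ F) → (∀ i, A i ⊂ A (i + 1)) → (⋃ i, A i) ∈ F

/-- `B¹_down(G)`: the downward closure of the family of rows of the game. -/
def B1down {S T : Type*} (π : S → T → Prop) : Set (Set T) :=
  {A | ∃ s, A ⊆ {t | π s t}}

/-- An ascending-union closed family contains every countable set all of whose finite subsets it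
contains. -/
theorem AscendingUnionClosed.mem_of_forall_finite {X : Type*} {F : Set (Set X)}
    (hF : AscendingUnionClosed F) {A : Set X} (hA : A.Countable)
    (hfin : ∀ K ⊆ A, K.Finite → K ∈ F) : A ∈ F := by
  by_cases hAf : A.Finite
  · exact hfin A subset_rfl hAf
  have : Infinite A := Set.infinite_coe_iff.2 hAf
  have : Countable A := hA.to_subtype
  obtain ⟨e⟩ : Nonempty (ℕ ≃ A) := nonempty_equiv_of_countable
  have he : Function.Injective fun n => (e n : X) := Subtype.val_injective.comp e.injective
  have hunion : ⋃ n, (fun k => (e k : X)) '' Set.Iio n = A := by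
    ext x
    simp only [Set.mem_iUnion, Set.mem_image, Set.mem_Iio]
    constructor
    · rintro ⟨n, k, -, rfl⟩
      exact (e k).2
    · intro hx
      exact ⟨e.symm ⟨x, hx⟩ + 1, e.symm ⟨x, hx⟩, Nat.lt_succ_self _, by simp⟩
  rw [← hunion]
  refine hF _ (fun n => hfin _ ?_ ((Set.finite_Iio n).image _)) fun n => ?_
  · rintro _ ⟨k, -, rfl⟩
    exact (e k).2
  · exact he.image_strictMono (Set.Iio_ssubset_Iio (Nat.lt_succ_self n))

theorem mixedPayoff_eq_tsum_mul {S T : Type*} (π : S → T → Prop) (p : PMF S) (q : PMF T) :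
    mixedPayoff π p q = ∑' s, p s * ∑' t, q t * (if π s t then 1 else 0) := by
  simp only [mixedPayoff, mul_assoc, ENNReal.tsum_mul_left]

theorem mixedPayoff_pure {S T : Type*} (π : S → T → Prop) (s : S) (q : PMF T) :
    mixedPayoff π (PMF.pure s) q = ∑' t, q t * (if π s t then 1 else 0) := by
  rw [mixedPayoff_eq_tsum_mul, tsum_eq_single s]
  · simp
  · intro s' hs'
    simp [PMF.pure_apply, hs']

theorem mixedPayoff_le_iSup_pure {S T : Type*} (π : S → T → Prop) (p : PMF S) (q : PMF T) :
    mixedPayoff π p q ≤ ⨆ s, mixedPayoff π (PMF.pure s) q := by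
  calc mixedPayoff π p q = ∑' s, p s * mixedPayoff π (PMF.pure s) q := by
        simp only [mixedPayoff_eq_tsum_mul π p, mixedPayoff_pure]
    _ ≤ ∑' s, p s * ⨆ s, mixedPayoff π (PMF.pure s) q :=
        ENNReal.tsum_le_tsum fun s => by
          gcongr
          exact le_iSup (fun s => mixedPayoff π (PMF.pure s) q) s
    _ = ⨆ s, mixedPayoff π (PMF.pure s) q := by
        rw [ENNReal.tsum_mul_right, p.tsum_coe, one_mul]

/-- The limit of the probabilities of a family of events along an ultrafilter is at most the
probability of the limit event. -/
theorem PMF.le_tsum_of_tendsto_ultrafilter {S T : Type*} (π : S → T → Prop) (q : PMF T)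
    (U : Ultrafilter S) {M : ℝ≥0∞}
    (hM : Filter.Tendsto (fun s => ∑' t, q t * (if π s t then 1 else 0)) U (nhds M)) :
    M ≤ ∑' t, q t * (if ∀ᶠ s in U, π s t then 1 else 0) := by
  refine ENNReal.le_of_forall_pos_le_add fun ε hε _ => ?_
  obtain ⟨K, hK⟩ := ((ENNReal.tendsto_tsum_compl_atTop_zero q.tsum_coe_ne_top).eventually
    (Iio_mem_nhds (ENNReal.coe_pos.2 hε))).exists
  have hagree : ∀ᶠ s in (U : Filter S), ∀ t ∈ K, π s t → ∀ᶠ s in U, π s t := by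
    refine (Filter.eventually_all_finset K).2 fun t _ => ?_
    by_cases ht : ∀ᶠ s in (U : Filter S), π s t
    · exact Filter.Eventually.of_forall fun _ _ => ht
    · filter_upwards [Ultrafilter.eventually_not.2 ht] with s hs hs'
      exact absurd hs' hs
  refine le_of_tendsto hM ?_
  filter_upwards [hagree] with s hs
  rw [← ENNReal.sum_add_tsum_compl K]
  gcongr ?_ + ?_
  · refine (Finset.sum_le_sum fun t ht => ?_).trans (ENNReal.sum_le_tsum K)
    by_cases h : π s t
    · rw [if_pos h, if_pos (hs t ht h)]
    · simp [h]
  · refine (ENNReal.tsum_le_tsum fun t => ?_).trans (le_of_lt hK)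
    split_ifs <;> simp

/-- In a countable game whose family `B¹_down(G)` is ascending-union closed, player 1
always has an exact pure best response against any mixed strategy of player 2. -/
theorem exists_pure_best_response
    {S T : Type*} [Countable S] [Infinite S] [Countable T] [Infinite T]
    (π : S → T → Prop) (h : AscendingUnionClosed (B1down π)) :
    ∀ q : PMF T, ∃ s : S,
      mixedPayoff π (PMF.pure s) q = ⨆ p : PMF S, mixedPayoff π p q := by
  intro q
  set f : S → ℝ≥0∞ := fun s => mixedPayoff π (PMF.pure s) q with hf
  obtain ⟨u, -, hu, hu_mem⟩ := exists_seq_tendsto_sSup (Set.range_nonempty f)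
    (OrderTop.bddAbove (Set.range f))
  choose v hv using hu_mem
  let U : Ultrafilter S := (Filter.hyperfilter ℕ).map v
  have hU : Filter.Tendsto f U (nhds (⨆ s, f s)) := by
    rw [Ultrafilter.coe_map, Filter.tendsto_map'_iff]
    have hfv : f ∘ v = u := funext hv
    rw [hfv]
    exact hu.mono_left Nat.hyperfilter_le_atTop
  obtain ⟨s, hs⟩ : {t | ∀ᶠ s in U, π s t} ∈ B1down π := by
    refine h.mem_of_forall_finite (Set.to_countable _) fun K hK hKf => ?_
    have hev : ∀ᶠ s in (U : Filter S), ∀ t ∈ K, π s t :=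
      (Filter.eventually_all_finite hKf).2 fun t ht => hK ht
    obtain ⟨s, hs⟩ := hev.exists
    exact ⟨s, hs⟩
  refine ⟨s, le_antisymm (le_iSup (fun p => mixedPayoff π p q) _) (iSup_le fun p => ?_)⟩
  refine (mixedPayoff_le_iSup_pure π p q).trans ?_
  simp only [hf, mixedPayoff_pure] at hU ⊢
  refine (q.le_tsum_of_tendsto_ultrafilter π U hU).trans (ENNReal.tsum_le_tsum fun t => ?_)
  by_cases ht : ∀ᶠ s in U, π s t
  · simp [ht, show π s t from hs ht]
  · simp [ht]
end

section
/- Let G = (S, T, π) be a countable two-person win-lose game such that every set in the family B²(G) is finite, and assume G is LNG-free. Then G satisfies the minimax property with value 1: sup over mixed strategies p on S of the min over mixed strategies q on T of π^mix(p,q) equals 1, and the min over mixed strategies q on T of the sup over mixed strategies p on S of π^mix(p,q) equals 1. -/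
open scoped ENNReal Classical

/-- A game is LNG-free if no subgame of it is isomorphic to the larger number game. -/
def LNGFree {S T : Type*} (π : S → T → Prop) : Prop :=
  ¬ ∃ (s : ℕ → S) (t : ℕ → T), Function.Injective s ∧ Function.Injective t ∧
      ∀ i j, π (s i) (t j) ↔ j ≤ i

/-- In an LNG-free game whose sets `{s | ¬ π s t}` are finite, a set all of whose finite subsets
lie in some `{s | ¬ π s t}` is finite. -/
theorem LNGFree.finite_of_forall_finset_subset {S T : Type*} {π : S → T → Prop}
    (hLNG : LNGFree π) (hfin : ∀ t, {s | ¬ π s t}.Finite) {C : Set S}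
    (hC : ∀ F : Finset S, (F : Set S) ⊆ C → ∃ t, ∀ s ∈ F, ¬ π s t) : C.Finite := by
  by_contra hinf
  apply hLNG
  obtain ⟨f, hf, hlt⟩ := exists_seq_of_forall_finset_exists
    (fun x : S × T ↦ x.1 ∈ C ∧ π x.1 x.2) (fun x y ↦ ¬ π x.1 y.2 ∧ π y.1 x.2) (by
      intro F hF
      obtain ⟨t, ht⟩ := hC (F.image Prod.fst) (by
        intro s hs
        obtain ⟨x, hx, rfl⟩ := Finset.mem_image.1 hs
        exact (hF x hx).1)
      have hbad : ({s | ¬ π s t} ∪ ⋃ x ∈ F, {s | ¬ π s x.2}).Finite :=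
        (hfin t).union (F.finite_toSet.biUnion fun x _ ↦ hfin x.2)
      obtain ⟨s, hsC, hs⟩ := (Set.Infinite.sdiff hinf hbad).nonempty
      simp only [Set.mem_union, Set.mem_iUnion, not_or, not_exists, Set.mem_ofPred_eq,
        not_not] at hs
      exact ⟨(s, t), ⟨hsC, hs.1⟩, fun x hx ↦
        ⟨ht _ (Finset.mem_image_of_mem _ hx), hs.2 x hx⟩⟩)
  have key : ∀ i j, π (f i).1 (f j).2 ↔ j ≤ i := by
    intro i j
    rcases lt_trichotomy i j with h | rfl | h
    · simp [(hlt i j h).1, h]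
    · simp [(hf i).2]
    · simp [(hlt j i h).2, h.le]
  refine ⟨fun i ↦ (f i).1, fun j ↦ (f j).2, fun i j h ↦ ?_, fun i j h ↦ ?_, key⟩
  · have h₁ := key i j
    have h₂ := key j i
    simp only at h
    rw [h, key] at h₁
    rw [← h, key] at h₂
    omega
  · have h₁ := key i j
    have h₂ := key j i
    simp only at h
    rw [← h, key] at h₁
    rw [h, key] at h₂
    omega

/-- A nonnegative finitely additive set function, defined on all subsets. -/
structure IsFinitelyAdditive {T : Type*} (m : Set T → ℝ) : Prop where
  nonneg : ∀ A, 0 ≤ m A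
  empty : m ∅ = 0
  union_add_inter : ∀ A B, m (A ∪ B) + m (A ∩ B) = m A + m B

namespace IsFinitelyAdditive

variable {S T : Type*} {m : Set T → ℝ}

theorem mono (hm : IsFinitelyAdditive m) {A B : Set T} (h : A ⊆ B) : m A ≤ m B := by
  have h₁ := hm.union_add_inter A (B \ A)
  have h₂ := hm.nonneg (B \ A)
  rw [Set.union_sdiff_cancel h, Set.inter_sdiff_self, hm.empty] at h₁
  linarith

theorem union_le (hm : IsFinitelyAdditive m) (A B : Set T) : m (A ∪ B) ≤ m A + m B := by
  have h₁ := hm.union_add_inter A B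
  have h₂ := hm.nonneg (A ∩ B)
  linarith

theorem biUnion_le_card_mul (hm : IsFinitelyAdditive m) (E : S → Set T) {δ : ℝ} (F : Finset S)
    (h : ∀ i ∈ F, m (E i) ≤ δ) : m (⋃ i ∈ F, E i) ≤ F.card * δ := by
  induction F using Finset.induction_on with
  | empty => simp [hm.empty]
  | insert a F ha ih =>
    rw [Finset.set_biUnion_insert, Finset.card_insert_of_notMem ha]
    have h₁ := hm.union_le (E a) (⋃ i ∈ F, E i)
    have h₂ := ih fun i hi ↦ h i (Finset.mem_insert_of_mem hi)
    have h₃ := h a (Finset.mem_insert_self a F)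
    push_cast
    linarith

/-- Among infinitely many sets of mass at least `c`, some member meets infinitely many others in
mass bounded below. -/
theorem exists_infinite_le_inter (hm : IsFinitelyAdditive m) (E : S → Set T) {I : Set S}
    (hI : I.Infinite) {c : ℝ} (hc : 0 < c) (hE : ∀ s ∈ I, c ≤ m (E s)) :
    ∃ i ∈ I, ∃ δ > 0, {s ∈ I | δ ≤ m (E i ∩ E s)}.Infinite := by
  by_contra! hfin
  have key : ∀ N : ℕ, ∃ F : Finset S, (F : Set S) ⊆ I ∧ N * (c / 2) ≤ m (⋃ i ∈ F, E i) := by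
    intro N
    induction N with
    | zero => exact ⟨∅, by simp, by simp [hm.empty]⟩
    | succ N ih =>
      obtain ⟨F, hFI, hF⟩ := ih
      set δ : ℝ := c / 2 / (F.card + 1) with hδ
      have hδ0 : 0 < δ := by positivity
      have hbad : (⋃ i ∈ F, {s ∈ I | δ ≤ m (E i ∩ E s)}).Finite :=
        F.finite_toSet.biUnion fun i hi ↦ hfin i (hFI hi) δ hδ0
      obtain ⟨s, hsI, hs⟩ := (hI.sdiff hbad).nonempty
      simp only [Set.mem_iUnion, not_exists, Set.mem_ofPred_eq, not_and, not_le] at hs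
      refine ⟨insert s F, ?_, ?_⟩
      · rw [Finset.coe_insert]
        exact Set.insert_subset hsI hFI
      · have h₁ := hm.union_add_inter (E s) (⋃ i ∈ F, E i)
        have h₂ := hm.biUnion_le_card_mul (fun i ↦ E i ∩ E s) F fun i hi ↦ (hs i hi hsI).le
        rw [← Set.iUnion₂_inter, Set.inter_comm] at h₂
        have h₃ : (F.card : ℝ) * δ ≤ c / 2 := by
          rw [hδ, mul_div_assoc', div_le_iff₀ (by positivity)]
          nlinarith
        rw [Finset.set_biUnion_insert]
        have h₄ := hE s hsI
        push_cast
        linarith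
  obtain ⟨N, hN⟩ := exists_nat_gt (m Set.univ / (c / 2))
  obtain ⟨F, -, hF⟩ := key N
  rw [div_lt_iff₀ (by positivity)] at hN
  linarith [hm.mono (Set.subset_univ (⋃ i ∈ F, E i))]

/-- Among infinitely many sets of mass at least `c` there are infinitely many with the finite
intersection property. -/
theorem exists_infinite_forall_finset_nonempty (hm : IsFinitelyAdditive m) [Infinite S]
    (E : S → Set T) {c : ℝ} (hc : 0 < c) (hE : ∀ s, c ≤ m (E s)) :
    ∃ C : Set S, C.Infinite ∧
      ∀ F : Finset S, (F : Set S) ⊆ C → (⋂ s ∈ F, E s).Nonempty := by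
  let Good (A : Finset S) : Prop :=
    ∃ c > 0, {s | c ≤ m ((⋂ i ∈ A, E i) ∩ E s)}.Infinite
  have good_empty : Good ∅ := ⟨c, hc, by simpa [hE] using Set.infinite_univ⟩
  have : Nonempty {A // Good A} := ⟨⟨∅, good_empty⟩⟩
  have : NoMaxOrder {A // Good A} := ⟨by
    rintro ⟨A, c, hc, hA⟩
    obtain ⟨i, hi, δ, hδ, hinf⟩ := hm.exists_infinite_le_inter
      (fun s ↦ (⋂ i ∈ A, E i) ∩ E s) (hA.sdiff A.finite_toSet) hc fun s hs ↦ hs.1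
    refine ⟨⟨insert i A, δ, hδ, hinf.mono ?_⟩, Finset.ssubset_insert hi.2⟩
    rintro s ⟨-, hs⟩
    refine hs.trans (hm.mono ?_)
    rw [Finset.set_biInter_insert]
    rintro t ⟨⟨h₁, h₂⟩, -, h₃⟩
    exact ⟨⟨h₂, h₁⟩, h₃⟩⟩
  obtain ⟨f, hf⟩ := Nat.exists_strictMono {A // Good A}
  refine ⟨⋃ n, ((f n).1 : Set S), fun hfin ↦ ?_, fun F hF ↦ ?_⟩
  · refine Set.infinite_of_injective_forall_mem (f := fun n ↦ (f n).1)
      (Subtype.val_injective.comp hf.injective) (s := (hfin.toFinset.powerset : Set (Finset S)))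
      (fun n ↦ ?_) (Finset.finite_toSet _)
    rw [Finset.mem_coe, Finset.mem_powerset, Set.Finite.subset_toFinset]
    exact Set.subset_iUnion (fun n ↦ ((f n).1 : Set S)) n
  · obtain ⟨n, hn⟩ := Directed.exists_mem_subset_of_finset_subset_biUnion
      (Monotone.directed_le fun a b hab ↦ Finset.coe_subset.2 (hf.monotone hab)) hF
    obtain ⟨c, hc, hinf⟩ := (f n).2
    obtain ⟨s, hs⟩ := hinf.nonempty
    have hne : ((⋂ i ∈ (f n).1, E i) ∩ E s).Nonempty := by
      rw [Set.nonempty_iff_ne_empty]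
      intro h
      rw [Set.mem_ofPred_eq, h, hm.empty] at hs
      linarith
    exact hne.mono (Set.inter_subset_left.trans (Set.biInter_subset_biInter_left hn))

end IsFinitelyAdditive

open scoped Pointwise BoundedContinuousFunction in
/-- Hahn–Banach alternative: either some finite convex combination of the indicators of the `E s`
is uniformly at most `ε`, or some finitely additive set function is bounded below on the `E s`. -/
theorem exists_finsupp_sum_le_or_exists_isFinitelyAdditive {S T : Type*} (E : S → Set T) {ε : ℝ}
    (hε : 0 < ε) :
    (∃ w : S →₀ ℝ, (∀ s, 0 ≤ w s) ∧ (w.sum fun _ a ↦ a) = 1 ∧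
      ∀ t, (w.sum fun s a ↦ a * (E s).indicator 1 t) ≤ ε) ∨
    ∃ m : Set T → ℝ, IsFinitelyAdditive m ∧ ∃ c > 0, ∀ s, c ≤ m (E s) := by
  let _ : TopologicalSpace T := ⊥
  have : DiscreteTopology T := ⟨rfl⟩
  let ind (A : Set T) : T →ᵇ ℝ := BoundedContinuousFunction.indicator A (isClopen_discrete A)
  have ind_apply (A : Set T) (t : T) : ind A t = A.indicator 1 t := rfl
  let W : Set (S →₀ ℝ) := {w | (∀ s, 0 ≤ w s) ∧ Finsupp.linearCombination ℝ (fun _ ↦ (1 : ℝ)) w = 1}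
  have hW : Convex ℝ W := by
    rintro v ⟨hv, hv'⟩ w ⟨hw, hw'⟩ a b ha hb hab
    refine ⟨fun s ↦ ?_, by rw [map_add, map_smul, map_smul, hv', hw']; simpa using hab⟩
    have := hv s
    have := hw s
    simp only [Finsupp.coe_add, Finsupp.coe_smul, Pi.add_apply, Pi.smul_apply, smul_eq_mul]
    positivity
  let L : (S →₀ ℝ) →ₗ[ℝ] (T →ᵇ ℝ) := Finsupp.linearCombination ℝ fun s ↦ ind (E s)
  let K : Set (T →ᵇ ℝ) := {g | ∀ t, g t ≤ 0}
  have hK : Convex ℝ K := by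
    intro g hg h hh a b ha hb _ t
    have h₁ := mul_nonneg ha (neg_nonneg.2 (hg t))
    have h₂ := mul_nonneg hb (neg_nonneg.2 (hh t))
    simp only [BoundedContinuousFunction.coe_add, BoundedContinuousFunction.coe_smul,
      Pi.add_apply, smul_eq_mul]
    linarith
  by_cases hdisj : Disjoint (Metric.ball 0 ε + K) (L '' W)
  · right
    obtain ⟨f, u, hfu, huf⟩ := geometric_hahn_banach_open ((convex_ball 0 ε).add hK)
      Metric.isOpen_ball.add_right (hW.linear_image L) hdisj
    have f_nonneg : ∀ g : T →ᵇ ℝ, (∀ t, 0 ≤ g t) → 0 ≤ f g := by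
      intro g hg
      by_contra! hneg
      have h (r : ℝ) (hr : 0 ≤ r) : -(r * f g) < u := by
        have := hfu (0 + -(r • g)) (Set.add_mem_add (Metric.mem_ball_self hε) fun t ↦ by
          simpa using mul_nonneg hr (hg t))
        simpa using this
      have := h (|u| / -f g) (by have := neg_pos.2 hneg; positivity)
      have h' : -(|u| / -f g * f g) = |u| := by
        rw [div_neg, neg_mul, neg_neg, div_mul_cancel₀ _ hneg.ne]
      rw [h'] at this
      exact absurd (le_abs_self u) (not_le.2 this)
    refine ⟨fun A ↦ f (ind A), ⟨fun A ↦ f_nonneg _ fun t ↦ ?_, ?_, fun A B ↦ ?_⟩, u, ?_, fun s ↦ ?_⟩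
    · exact Set.indicator_nonneg (fun _ _ ↦ zero_le_one) t
    · have : ind ∅ = 0 := by ext t; simp [ind_apply]
      rw [this, map_zero]
    · rw [← map_add, ← map_add]
      congr 1
      ext t
      exact congrFun (Set.indicator_union_add_inter 1 A B) t
    · have := hfu (0 + 0) (Set.add_mem_add (Metric.mem_ball_self hε) fun t ↦ le_rfl)
      simpa using this
    · refine huf _ ⟨Finsupp.single s 1, ⟨fun i ↦ ?_, by simp⟩, by simp [L]⟩
      exact Finsupp.single_nonneg.2 zero_le_one i
  · left
    obtain ⟨_, ⟨b, hb, k, hk, rfl⟩, w, ⟨hw, hw'⟩, hwL⟩ := Set.not_disjoint_iff.1 hdisj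
    refine ⟨w, hw, by simpa [Finsupp.linearCombination_apply] using hw', fun t ↦ ?_⟩
    have h₁ : b t ≤ ε := (le_abs_self _).trans
      ((b.norm_coe_le_norm t).trans (mem_ball_zero_iff.1 hb).le)
    have h₂ := congrArg (fun g : T →ᵇ ℝ ↦ g t) hwL
    simp only [L, Finsupp.linearCombination_apply, Finsupp.sum, BoundedContinuousFunction.coe_sum,
      Finset.sum_apply, BoundedContinuousFunction.coe_smul, smul_eq_mul, ind_apply,
      BoundedContinuousFunction.coe_add, Pi.add_apply] at h₂
    have h₃ := hk t
    rw [Finsupp.sum, h₂]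
    linarith

/-- The probability that player 1 wins with mixed strategy `p` against the pure strategy `t`. -/
noncomputable def purePayoff {S T : Type*} (π : S → T → Prop) (p : PMF S) (t : T) : ℝ≥0∞ :=
  ∑' s, p s * (if π s t then 1 else 0)

section

variable {S T : Type*} (π : S → T → Prop)

theorem mixedPayoff_eq_tsum_purePayoff (p : PMF S) (q : PMF T) :
    mixedPayoff π p q = ∑' t, q t * purePayoff π p t := by
  rw [mixedPayoff, ENNReal.tsum_comm]
  refine tsum_congr fun t ↦ ?_
  rw [purePayoff, ← ENNReal.tsum_mul_left]
  exact tsum_congr fun s ↦ by ring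

theorem le_mixedPayoff {p : PMF S} {a : ℝ≥0∞} (h : ∀ t, a ≤ purePayoff π p t) (q : PMF T) :
    a ≤ mixedPayoff π p q := by
  rw [mixedPayoff_eq_tsum_purePayoff]
  calc a = ∑' t, q t * a := by rw [ENNReal.tsum_mul_right, q.tsum_coe, one_mul]
    _ ≤ _ := ENNReal.tsum_le_tsum fun t ↦ by gcongr; exact h t

theorem purePayoff_le_one (p : PMF S) (t : T) : purePayoff π p t ≤ 1 := by
  rw [← p.tsum_coe]
  exact ENNReal.tsum_le_tsum fun s ↦ by split_ifs <;> simp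

theorem mixedPayoff_le_one (p : PMF S) (q : PMF T) : mixedPayoff π p q ≤ 1 := by
  rw [mixedPayoff_eq_tsum_purePayoff, ← q.tsum_coe]
  exact ENNReal.tsum_le_tsum fun t ↦ mul_le_of_le_one_right' (purePayoff_le_one π p t)

theorem mixedPayoff_pure_right (p : PMF S) (t : T) :
    mixedPayoff π p (PMF.pure t) = purePayoff π p t := by
  rw [mixedPayoff_eq_tsum_purePayoff, tsum_eq_single t (by
    intro t' h
    simp [PMF.pure_apply, h])]
  simp

theorem mixedPayoff_pure_left (s : S) (q : PMF T) :
    mixedPayoff π (PMF.pure s) q = ∑' t, q t * (if π s t then 1 else 0) := by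
  rw [mixedPayoff, tsum_eq_single s (by
    intro s' h
    simp [PMF.pure_apply, h])]
  simp

variable {π}

theorem iSup_mixedPayoff_eq_one [Infinite S] (hfin : ∀ t, {s | ¬ π s t}.Finite) (q : PMF T) :
    ⨆ p : PMF S, mixedPayoff π p q = 1 := by
  refine le_antisymm (iSup_le fun p ↦ mixedPayoff_le_one π p q) (le_of_forall_lt fun a ha ↦ ?_)
  rw [← q.tsum_coe, ENNReal.tsum_eq_iSup_sum, lt_iSup_iff] at ha
  obtain ⟨F, hF⟩ := ha
  obtain ⟨s, hs⟩ := (F.finite_toSet.biUnion fun t _ ↦ hfin t).exists_notMem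
  simp only [Set.mem_iUnion, not_exists, Set.mem_ofPred_eq, not_not] at hs
  refine hF.trans_le (le_iSup_of_le (PMF.pure s) ?_)
  rw [mixedPayoff_pure_left]
  calc ∑ t ∈ F, q t = ∑ t ∈ F, q t * (if π s t then 1 else 0) :=
        Finset.sum_congr rfl fun t ht ↦ by simp [hs t ht]
    _ ≤ _ := ENNReal.sum_le_tsum F

theorem LNGFree.exists_forall_le_purePayoff [Infinite S] (hLNG : LNGFree π)
    (hfin : ∀ t, {s | ¬ π s t}.Finite) {ε : ℝ} (hε : 0 < ε) :
    ∃ p : PMF S, ∀ t, 1 - ENNReal.ofReal ε ≤ purePayoff π p t := by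
  rcases exists_finsupp_sum_le_or_exists_isFinitelyAdditive (fun s ↦ {t | ¬ π s t}) hε with
    ⟨w, hw, hw₁, hwε⟩ | ⟨m, hm, c, hc, hcm⟩
  · let p : PMF S := PMF.ofFinset (fun s ↦ ENNReal.ofReal (w s)) w.support
      (by rw [← ENNReal.ofReal_sum_of_nonneg fun s _ ↦ hw s]
          change ENNReal.ofReal (w.sum fun _ a ↦ a) = 1
          simp [hw₁])
      (fun s hs ↦ by simp [Finsupp.notMem_support_iff.1 hs])
    refine ⟨p, fun t ↦ ?_⟩
    have hlose : ∑' s, p s * (if π s t then 0 else 1) ≤ ENNReal.ofReal ε := by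
      rw [tsum_eq_sum (s := w.support) (fun s hs ↦ by
        simp [p, Finsupp.notMem_support_iff.1 hs])]
      refine le_trans (le_of_eq ?_) (ENNReal.ofReal_le_ofReal (hwε t))
      rw [Finsupp.sum, ENNReal.ofReal_sum_of_nonneg fun s _ ↦
        mul_nonneg (hw s) (Set.indicator_nonneg (f := 1) (fun _ _ ↦ zero_le_one) t)]
      refine Finset.sum_congr rfl fun s _ ↦ ?_
      by_cases h : π s t <;> simp [p, h, Set.indicator]
    rw [tsub_le_iff_right]
    calc (1 : ℝ≥0∞) = purePayoff π p t + ∑' s, p s * (if π s t then 0 else 1) := by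
          rw [purePayoff, ← ENNReal.tsum_add, ← p.tsum_coe]
          refine tsum_congr fun s ↦ ?_
          split_ifs <;> simp
      _ ≤ _ := by gcongr
  · obtain ⟨C, hC, hCF⟩ := hm.exists_infinite_forall_finset_nonempty _ hc hcm
    refine absurd (hLNG.finite_of_forall_finset_subset hfin fun F hF ↦ ?_) hC
    obtain ⟨t, ht⟩ := hCF F hF
    exact ⟨t, fun s hs ↦ Set.mem_iInter₂.1 ht s hs⟩

open Filter Topology in
theorem LNGFree.exists_forall_purePayoff_le [Nonempty T] (hLNG : LNGFree π)
    (hfin : ∀ t, {s | ¬ π s t}.Finite) (p : PMF S) :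
    ∃ t, ∀ t', purePayoff π p t ≤ purePayoff π p t' := by
  let g (t : T) : ℝ≥0∞ := purePayoff π p t
  obtain ⟨v, -, hv, hvr⟩ := exists_seq_tendsto_sInf (Set.range_nonempty g) (OrderBot.bddBelow _)
  choose t ht using hvr
  let U : Ultrafilter ℕ := hyperfilter ℕ
  have hU : (U : Filter ℕ) ≤ atTop := Nat.hyperfilter_le_atTop
  have hgU : Tendsto (fun n ↦ g (t n)) U (𝓝 (sInf (Set.range g))) := by
    simpa only [ht] using hv.mono_left hU
  let C : Set S := {s | ∀ᶠ n in U, ¬ π s (t n)}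
  have hCfin : C.Finite := hLNG.finite_of_forall_finset_subset hfin fun F hF ↦ by
    obtain ⟨n, hn⟩ := ((eventually_all_finset F).2 fun s hs ↦ hF hs).exists
    exact ⟨t n, hn⟩
  have hp : Summable fun s ↦ (p s).toReal := ENNReal.summable_toReal (by simp [p.tsum_coe])
  have hsum {b : S → ℝ} (hb : ∀ s, 0 ≤ b s ∧ b s ≤ 1) : Summable fun s ↦ (p s).toReal * b s :=
    hp.of_nonneg_of_le (fun s ↦ mul_nonneg ENNReal.toReal_nonneg (hb s).1)
      fun s ↦ mul_le_of_le_one_right ENNReal.toReal_nonneg (hb s).2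
  let ind (s : S) : ℝ := if s ∈ C then 0 else 1
  have hlim : Tendsto (fun n ↦ ∑' s, (p s).toReal * (if π s (t n) then 1 else 0)) U
      (𝓝 (∑' s, (p s).toReal * ind s)) := by
    refine tendsto_tsum_of_dominated_convergence (bound := fun s ↦ (p s).toReal)
      hp (fun s ↦ ?_) (Eventually.of_forall fun n s ↦ ?_)
    · refine tendsto_const_nhds.congr' ?_
      by_cases hs : s ∈ C
      · filter_upwards [show ∀ᶠ n in U, ¬ π s (t n) from hs] with n hn
        simp [ind, hs, hn]
      · filter_upwards [Ultrafilter.eventually_not.not_left.1 hs] with n hn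
        simp [ind, hs, hn]
    · split_ifs <;> simp
  have hg : ∀ t', g t' = ENNReal.ofReal (∑' s, (p s).toReal * (if π s t' then 1 else 0)) := by
    intro t'
    rw [ENNReal.ofReal_tsum_of_nonneg (fun s ↦ by positivity) (hsum fun s ↦ by split_ifs <;> simp)]
    refine tsum_congr fun s ↦ ?_
    split_ifs <;> simp [ENNReal.ofReal_toReal (p.apply_ne_top s)]
  have hgC : sInf (Set.range g) = ENNReal.ofReal (∑' s, (p s).toReal * ind s) := by
    refine tendsto_nhds_unique hgU ?_
    simp only [hg]
    exact ENNReal.tendsto_ofReal hlim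
  obtain ⟨n, hn⟩ : ∃ n, ∀ s ∈ C, ¬ π s (t n) :=
    ((eventually_all_finite hCfin).2 fun s hs ↦ hs).exists
  refine ⟨t n, fun t' ↦ ?_⟩
  calc g (t n) ≤ sInf (Set.range g) := by
        rw [hgC, hg]
        refine ENNReal.ofReal_le_ofReal (Summable.tsum_le_tsum (fun s ↦ ?_)
          (hsum fun s ↦ by split_ifs <;> simp) (hsum fun s ↦ by simp only [ind]; split_ifs <;> simp))
        by_cases hs : s ∈ C
        · simp [hn s hs, ind, hs]
        · simp only [ind, hs, if_false]
          gcongr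
          split_ifs <;> simp
    _ ≤ g t' := sInf_le ⟨t', rfl⟩

end

/-- Corollary 2.12: a countable LNG-free game in which every set `B_t = {s | ¬ π s t}`
is finite satisfies the minimax property with value `1`, in the form
`sup_p min_q = 1 = min_q sup_p` (the minima over `q` being attained). -/
theorem minimax_value_one_of_finite_columns_LNGFree
    {S T : Type*} [Countable S] [Infinite S] [Countable T] [Infinite T]
    (π : S → T → Prop) (hfin : ∀ t, {s | ¬ π s t}.Finite) (hLNG : LNGFree π) :
    (⨆ p : PMF S, ⨅ q : PMF T, mixedPayoff π p q) = 1 ∧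
    (⨅ q : PMF T, ⨆ p : PMF S, mixedPayoff π p q) = 1 ∧
    (∀ p : PMF S, ∃ q : PMF T, mixedPayoff π p q = ⨅ q' : PMF T, mixedPayoff π p q') := by
  have hatt : ∀ p : PMF S, ∃ q : PMF T, mixedPayoff π p q = ⨅ q' : PMF T, mixedPayoff π p q' := by
    intro p
    obtain ⟨t, ht⟩ := hLNG.exists_forall_purePayoff_le hfin p
    refine ⟨PMF.pure t, le_antisymm (le_iInf fun q ↦ ?_) (iInf_le _ _)⟩
    rw [mixedPayoff_pure_right]
    exact le_mixedPayoff π ht q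
  have : Nonempty (PMF T) := ⟨PMF.pure (Classical.arbitrary T)⟩
  refine ⟨le_antisymm ?_ ?_, ?_, hatt⟩
  · exact iSup_le fun p ↦ iInf_le_of_le (Classical.arbitrary _) (mixedPayoff_le_one π p _)
  · refine ENNReal.le_of_forall_pos_le_add fun ε hε _ ↦ ?_
    obtain ⟨p, hp⟩ := hLNG.exists_forall_le_purePayoff hfin (NNReal.coe_pos.2 hε)
    rw [ENNReal.ofReal_coe_nnreal] at hp
    rw [← tsub_le_iff_right]
    exact le_iSup_of_le p (le_iInf fun q ↦ le_mixedPayoff π hp q)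
  · simp [iSup_mixedPayoff_eq_one hfin]
end

section
/- Let G = (S, T, π) be a two-person win-lose game that violates the minimax property, i.e. sup_p inf_q π^mix(p,q) < inf_q sup_p π^mix(p,q). Then G has an at most countable subgame G' = (S', T', π') (S' ⊆ S and T' ⊆ T both at most countable) that also violates the minimax property; moreover G' can be chosen so that sup over mixed strategies p on S' of inf over mixed strategies q on T' of π^mix(p,q) is at most sup_p inf_q π^mix(p,q) computed in G, and inf over q on T' of sup over p on S' of π^mix(p,q) is at least inf_q sup_p π^mix(p,q) computed in G. -/
open scoped ENNReal Classical

/-- A countable set can be enlarged to a countable set closed under an operation that assigns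
a countable set to every finite set. -/
theorem Set.Countable.exists_countable_superset_closed {X : Type*} {A : Set X} (hA : A.Countable)
    (f : Finset X → Set X) (hf : ∀ F, (f F).Countable) :
    ∃ B : Set X, A ⊆ B ∧ B.Countable ∧ ∀ F : Finset X, (F : Set X) ⊆ B → f F ⊆ B := by
  let step : Set X → Set X := fun C => C ∪ ⋃ F ∈ {F : Finset X | (F : Set X) ⊆ C}, f F
  let C : ℕ → Set X := fun n => step^[n] A
  have hsucc (n : ℕ) : C (n + 1) = step (C n) := Function.iterate_succ_apply' step n A
  have hmono : Monotone C := monotone_nat_of_le_succ fun n => by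
    rw [hsucc]
    exact Set.subset_union_left
  have hcount (n : ℕ) : (C n).Countable := by
    induction n with
    | zero => exact hA
    | succ n ih =>
      rw [hsucc]
      refine ih.union (Set.Countable.biUnion ?_ fun F _ => hf F)
      refine ((Set.countable_ofPred_finite_subset ih).preimage Finset.coe_injective).mono ?_
      exact fun F hF => ⟨F.finite_toSet, hF⟩
  refine ⟨⋃ n, C n, Set.subset_iUnion C 0, Set.countable_iUnion hcount, fun F hF => ?_⟩
  obtain ⟨n, hn⟩ : ∃ n, (F : Set X) ⊆ C n :=
    hmono.directed_le.exists_mem_subset_of_finset_subset_biUnion hF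
  refine Set.Subset.trans ?_ (Set.subset_iUnion C (n + 1))
  rw [hsucc]
  exact (Set.subset_biUnion_of_mem (u := fun F : Finset X => f F) hn).trans Set.subset_union_right

/-- Finitely many points of `T` realize all traces of a relation on a finite subset of `S`. -/
theorem exists_finite_forall_exists_agree {S T : Type*} (π : S → T → Prop) (F : Finset S) :
    ∃ B : Set T, B.Finite ∧ ∀ t, ∃ t' ∈ B, ∀ s ∈ F, (π s t' ↔ π s t) := by
  let trace : T → (F → Prop) := fun t s => π s t
  obtain ⟨B, -, hB⟩ := Set.exists_subset_bijOn Set.univ trace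
  refine ⟨B, Set.Finite.of_finite_image (Set.toFinite _) hB.injOn, fun t => ?_⟩
  obtain ⟨t', ht', h⟩ := hB.surjOn (Set.mem_image_of_mem trace (Set.mem_univ t))
  exact ⟨t', ht', fun s hs => iff_of_eq (congrFun h ⟨s, hs⟩)⟩

/-- Every relation has countable nonempty sets `A` and `B` of rows and columns such that each
column agrees with a column in `B` on any given finite subset of `A`, and each row agrees with
a row in `A` on any given finite subset of `B`. -/
theorem exists_countable_forall_exists_agree {S T : Type*} [Nonempty S] [Nonempty T]
    (π : S → T → Prop) :
    ∃ (A : Set S) (B : Set T), A.Countable ∧ B.Countable ∧ A.Nonempty ∧ B.Nonempty ∧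
      (∀ F : Finset S, (F : Set S) ⊆ A → ∀ t, ∃ t' ∈ B, ∀ s ∈ F, (π s t' ↔ π s t)) ∧
      (∀ F : Finset T, (F : Set T) ⊆ B → ∀ s, ∃ s' ∈ A, ∀ t ∈ F, (π s' t ↔ π s t)) := by
  choose g hg hgπ using exists_finite_forall_exists_agree π
  choose k hk hkπ using exists_finite_forall_exists_agree (fun t s => π s t)
  obtain ⟨s₀⟩ := ‹Nonempty S›
  obtain ⟨t₀⟩ := ‹Nonempty T›
  obtain ⟨C, h₀, hC, hclosed⟩ :=
    (Set.toFinite {Sum.inl s₀, Sum.inr t₀}).countable.exists_countable_superset_closed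
      (fun F => Sum.inl '' k F.toRight ∪ Sum.inr '' g F.toLeft)
      (fun F => ((hk _).countable.image _).union ((hg _).countable.image _))
  refine ⟨Sum.inl ⁻¹' C, Sum.inr ⁻¹' C, hC.preimage Sum.inl_injective,
    hC.preimage Sum.inr_injective, ⟨s₀, h₀ (by simp)⟩, ⟨t₀, h₀ (by simp)⟩,
    fun F hF t => ?_, fun F hF s => ?_⟩
  · obtain ⟨t', ht', h⟩ := hgπ F t
    refine ⟨t', hclosed (F.map .inl) (by simpa using hF) (Or.inr ⟨t', ?_, rfl⟩), h⟩
    convert ht'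
    ext; simp
  · obtain ⟨s', hs', h⟩ := hkπ F s
    refine ⟨s', hclosed (F.map .inr) (by simpa using hF) (Or.inl ⟨s', ?_, rfl⟩), h⟩
    convert hs'
    ext; simp

namespace PMF

/-- Up to an error `ε`, the probability of an event depends only on its trace on a finite set. -/
theorem exists_finset_toOuterMeasure_le_add {X : Type*} (p : PMF X) {ε : ℝ≥0∞} (hε : 0 < ε) :
    ∃ F : Finset X, ∀ U V : Set X, (∀ x ∈ F, x ∈ U → x ∈ V) →
      p.toOuterMeasure U ≤ p.toOuterMeasure V + ε := by
  obtain ⟨F, hF⟩ :=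
    ((ENNReal.tendsto_tsum_compl_atTop_zero p.tsum_coe_ne_top).eventually_le_const hε).exists
  refine ⟨F, fun U V h => ?_⟩
  have htail : p.toOuterMeasure ((F : Set X)ᶜ) ≤ ε := by
    rw [toOuterMeasure_apply, ← tsum_subtype]
    exact hF
  calc p.toOuterMeasure U
      ≤ p.toOuterMeasure (V ∪ (F : Set X)ᶜ) := by
        refine MeasureTheory.measure_mono fun x hx => ?_
        by_cases hxF : x ∈ F
        · exact Or.inl (h x hxF hx)
        · exact Or.inr hxF
    _ ≤ p.toOuterMeasure V + p.toOuterMeasure ((F : Set X)ᶜ) := MeasureTheory.measure_union_le _ _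
    _ ≤ p.toOuterMeasure V + ε := by gcongr

theorem iInf_le_tsum_mul {X : Type*} (p : PMF X) (f : X → ℝ≥0∞) :
    ⨅ x, f x ≤ ∑' x, p x * f x := by
  calc ⨅ x, f x = ∑' x, p x * ⨅ y, f y := by rw [ENNReal.tsum_mul_right, p.tsum_coe, one_mul]
    _ ≤ ∑' x, p x * f x := by gcongr with x; exact iInf_le f x

theorem tsum_mul_le_iSup {X : Type*} (p : PMF X) (f : X → ℝ≥0∞) :
    ∑' x, p x * f x ≤ ⨆ x, f x := by
  calc ∑' x, p x * f x ≤ ∑' x, p x * ⨆ y, f y := by gcongr with x; exact le_iSup f x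
    _ = ⨆ x, f x := by rw [ENNReal.tsum_mul_right, p.tsum_coe, one_mul]

theorem tsum_pure_mul {X : Type*} (a : X) (f : X → ℝ≥0∞) :
    ∑' x, PMF.pure a x * f x = f a := by
  rw [tsum_eq_single a fun x hx => by simp [hx]]
  simp

end PMF

section MixedPayoff

variable {S T : Type*} (π : S → T → Prop)

theorem mixedPayoff_eq_tsum_left (p : PMF S) (q : PMF T) :
    mixedPayoff π p q = ∑' s, p s * q.toOuterMeasure {t | π s t} := by
  simp only [mixedPayoff, PMF.toOuterMeasure_apply, ← ENNReal.tsum_mul_left]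
  refine tsum_congr fun s => tsum_congr fun t => ?_
  by_cases h : π s t <;> simp [h]

theorem mixedPayoff_eq_tsum_right (p : PMF S) (q : PMF T) :
    mixedPayoff π p q = ∑' t, q t * p.toOuterMeasure {s | π s t} := by
  simp only [mixedPayoff, PMF.toOuterMeasure_apply, ← ENNReal.tsum_mul_left]
  rw [ENNReal.tsum_comm]
  refine tsum_congr fun t => tsum_congr fun s => ?_
  by_cases h : π s t <;> simp [h, mul_comm]

theorem iInf_mixedPayoff (p : PMF S) :
    ⨅ q : PMF T, mixedPayoff π p q = ⨅ t, p.toOuterMeasure {s | π s t} := by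
  simp only [mixedPayoff_eq_tsum_right]
  refine le_antisymm (le_iInf fun t => ?_) (le_iInf fun q => q.iInf_le_tsum_mul _)
  exact iInf_le_of_le (PMF.pure t) (PMF.tsum_pure_mul t _).le

theorem iSup_mixedPayoff (q : PMF T) :
    ⨆ p : PMF S, mixedPayoff π p q = ⨆ s, q.toOuterMeasure {t | π s t} := by
  simp only [mixedPayoff_eq_tsum_left]
  refine le_antisymm (iSup_le fun p => p.tsum_mul_le_iSup _) (iSup_le fun s => ?_)
  exact le_iSup_of_le (PMF.pure s) (PMF.tsum_pure_mul s _).ge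

theorem iSup_iInf_mixedPayoff_subgame_le {A : Set S} {B : Set T}
    (h : ∀ F : Finset S, (F : Set S) ⊆ A → ∀ t, ∃ t' ∈ B, ∀ s ∈ F, (π s t' ↔ π s t)) :
    (⨆ p : PMF A, ⨅ q : PMF B, mixedPayoff (fun (s : A) (t : B) => π s t) p q)
      ≤ ⨆ p : PMF S, ⨅ q : PMF T, mixedPayoff π p q := by
  refine iSup_le fun p => le_iSup_of_le (p.map Subtype.val) ?_
  rw [iInf_mixedPayoff, iInf_mixedPayoff]
  refine le_iInf fun t => ENNReal.le_of_forall_pos_le_add fun ε hε _ => ?_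
  obtain ⟨F, hF⟩ := p.exists_finset_toOuterMeasure_le_add (ENNReal.coe_pos.2 hε)
  obtain ⟨t', ht', hagree⟩ := h (F.map (.subtype _)) (by simp) t
  rw [PMF.toOuterMeasure_map_apply]
  refine iInf_le_of_le ⟨t', ht'⟩ (hF _ _ fun s hs => ?_)
  exact (hagree s (Finset.mem_map_of_mem _ hs)).1

theorem le_iInf_iSup_mixedPayoff_subgame {A : Set S} {B : Set T}
    (h : ∀ F : Finset T, (F : Set T) ⊆ B → ∀ s, ∃ s' ∈ A, ∀ t ∈ F, (π s' t ↔ π s t)) :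
    (⨅ q : PMF T, ⨆ p : PMF S, mixedPayoff π p q)
      ≤ ⨅ q : PMF B, ⨆ p : PMF A, mixedPayoff (fun (s : A) (t : B) => π s t) p q := by
  refine le_iInf fun q => iInf_le_of_le (q.map Subtype.val) ?_
  rw [iSup_mixedPayoff, iSup_mixedPayoff]
  refine iSup_le fun s => ENNReal.le_of_forall_pos_le_add fun ε hε _ => ?_
  obtain ⟨F, hF⟩ := q.exists_finset_toOuterMeasure_le_add (ENNReal.coe_pos.2 hε)
  obtain ⟨s', hs', hagree⟩ := h (F.map (.subtype _)) (by simp) s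
  rw [PMF.toOuterMeasure_map_apply]
  refine (hF _ {t | π s' t} fun t ht => ?_).trans ?_
  · exact (hagree t (Finset.mem_map_of_mem _ ht)).2
  · gcongr
    exact le_iSup (fun s : A => q.toOuterMeasure {t | π s t}) ⟨s', hs'⟩

end MixedPayoff

/-- Step 5 of the proof of Theorem 3.1: if a game violates the minimax property, then
it has an at most countable subgame that also violates it; moreover the subgame can be
chosen so that its `sup_p inf_q` is at most that of the full game and its
`inf_q sup_p` is at least that of the full game. -/
theorem exists_countable_subgame_violating_minimax
    {S T : Type*} [Nonempty S] [Nonempty T] (π : S → T → Prop)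
    (h : (⨆ p : PMF S, ⨅ q : PMF T, mixedPayoff π p q)
        < ⨅ q : PMF T, ⨆ p : PMF S, mixedPayoff π p q) :
    ∃ (S' : Set S) (T' : Set T), S'.Countable ∧ T'.Countable ∧ S'.Nonempty ∧ T'.Nonempty ∧
      ((⨆ p : PMF S', ⨅ q : PMF T', mixedPayoff (fun (s : S') (t : T') => π s t) p q)
        < ⨅ q : PMF T', ⨆ p : PMF S', mixedPayoff (fun (s : S') (t : T') => π s t) p q) ∧
      ((⨆ p : PMF S', ⨅ q : PMF T', mixedPayoff (fun (s : S') (t : T') => π s t) p q)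
        ≤ ⨆ p : PMF S, ⨅ q : PMF T, mixedPayoff π p q) ∧
      ((⨅ q : PMF T, ⨆ p : PMF S, mixedPayoff π p q)
        ≤ ⨅ q : PMF T', ⨆ p : PMF S', mixedPayoff (fun (s : S') (t : T') => π s t) p q) := by
  obtain ⟨A, B, hA, hB, hA₀, hB₀, hcol, hrow⟩ := exists_countable_forall_exists_agree π
  have hlower := iSup_iInf_mixedPayoff_subgame_le π hcol
  have hupper := le_iInf_iSup_mixedPayoff_subgame π hrow
  exact ⟨A, B, hA, hB, hA₀, hB₀, hlower.trans_lt (h.trans_le hupper), hlower, hupper⟩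
end
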